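/- For Dyck paths a and s of the same length with a ≤ s, V(uad, usd) = Σ_{t} V(a, t), where the sum is over all Dyck paths t of length |s| with t ≤ s. -/

import Mathlib

/-- A binary path is a list of steps: `true` = upstep `u`, `false` = downstep `d`. -/
abbrev BinPath := List Bool

/-- `ht P k` is the height of the `k`-th point of the path `P` (the point reached
after the first `k` steps). -/
def ht (P : BinPath) (k : ℕ) : ℤ :=
  ((P.take k).map (fun b => if b then (1 : ℤ) else -1)).sum

/-- The lattice order on binary paths of the same length: `P ≤ Q` iff
`hᵢ(P) ≤ hᵢ(Q)` for all `i`. -/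
def pathLe (P Q : BinPath) : Prop :=
  P.length = Q.length ∧ ∀ k, ht P k ≤ ht Q k

def pathLt (P Q : BinPath) : Prop := pathLe P Q ∧ P ≠ Q

/-- The maximum path `1ₙ = uⁿ`. -/
def maxPath (n : ℕ) : BinPath := List.replicate n true

/-- Step `i` (0-based) of `P` is a downstep whose endpoint is a valley, i.e. it is
followed by an upstep or it is the last step of `P`. -/
def isValley (P : BinPath) (i : ℕ) : Prop :=
  i < P.length ∧ P.getD i true = false ∧ P.getD (i + 1) true = true

/-- The number of valleys of `P`. -/
def numValleys (P : BinPath) : ℕ :=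
  ((Finset.range P.length).filter
    (fun i => P.getD i true = false ∧ P.getD (i + 1) true = true)).card

/-- The filling of `P`: every valley of `P` is turned into a peak
(each occurrence `du` whose middle point is a valley becomes `ud`, and a final
valley-`d` becomes `u`). -/
def fill (P : BinPath) : BinPath :=
  List.ofFn (fun i : Fin P.length =>
    if P.get i then P.getD (i.1 - 1) true else P.getD (i.1 + 1) true)

/-- The degree of `P`: the least `k` such that the `k`-fold iterated filling
of `P` is the maximum path. -/
noncomputable def degree (P : BinPath) : ℕ :=
  sInf {k | fill^[k] P = maxPath P.length}

/-- `fPath P` is the number of chains from `P` to the maximum path `1_{|P|}` of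
length `degree P` having small intervals. -/
noncomputable def fPath (P : BinPath) : ℕ :=
  Set.ncard {c : ℕ → BinPath |
    c 0 = P ∧ (∀ i, degree P ≤ i → c i = maxPath P.length) ∧
    ∀ i < degree P, pathLt (c i) (c (i + 1)) ∧ pathLe (c (i + 1)) (fill (c i))}

/-- Height of the lowest valley of `P`. -/
noncomputable def lv (P : BinPath) : ℤ :=
  sInf {h : ℤ | ∃ i, isValley P i ∧ ht P (i + 1) = h}

/-- Height of the highest valley of `P`. -/
noncomputable def hv (P : BinPath) : ℤ :=
  sSup {h : ℤ | ∃ i, isValley P i ∧ ht P (i + 1) = h}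

noncomputable def hvNat (P : BinPath) : ℕ := (hv P).toNat

/-- `P′`: every low valley of `P` is turned into a peak. -/
noncomputable def lowFill (P : BinPath) : BinPath :=
  List.ofFn (fun i : Fin P.length =>
    if P.get i then
      (if P.getD (i.1 - 1) true = false ∧ ht P i.1 = lv P then false else true)
    else
      (if P.getD (i.1 + 1) true = true ∧ ht P (i.1 + 1) = lv P then true else false))

/-- `P*`: every valley of `P` is turned into a peak, except the last one when `P`
ends with a downstep. -/
def starFill (P : BinPath) : BinPath :=
  List.ofFn (fun i : Fin P.length =>
    if i.1 + 1 = P.length ∧ P.get i = false then false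
    else if P.get i then P.getD (i.1 - 1) true else P.getD (i.1 + 1) true)

/-- A Dyck path: starts and ends at height 0 and lies weakly above height 0. -/
def IsDyck (P : BinPath) : Prop := ht P P.length = 0 ∧ ∀ k, 0 ≤ ht P k

/-- A Dyck prefix: a prefix of a Dyck path. -/
def IsDyckPrefix (P : BinPath) : Prop := ∃ Q : BinPath, IsDyck (P ++ Q)

/-- A Dyck suffix: a suffix of a Dyck path. -/
def IsDyckSuffix (P : BinPath) : Prop := ∃ Q : BinPath, IsDyck (Q ++ P)

/-- The pyramid `u^m d^m`. -/
def pyramid (m : ℕ) : BinPath := List.replicate m true ++ List.replicate m false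

/-- Cardinality of the interval `[P, Q]` in the lattice of binary paths. -/
noncomputable def intervalCard (P Q : BinPath) : ℕ :=
  Set.ncard {R : BinPath | pathLe P R ∧ pathLe R Q}

/-- `I(s) = |[s, u^{|s|/2} d^{|s|/2}]|`. -/
noncomputable def Ifun (s : BinPath) : ℕ := intervalCard s (pyramid (s.length / 2))

/-- `J(P) = |[P, u^{|P|}]|`. -/
noncomputable def Jfun (P : BinPath) : ℕ := intervalCard P (maxPath P.length)

/-- `P` and `Q` have exactly the same valleys at every height at most `m`. -/
def sameValleysUpTo (P Q : BinPath) (m : ℤ) : Prop :=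
  ∀ (i : ℕ) (t : ℤ), t ≤ m →
    ((isValley P i ∧ ht P (i + 1) = t) ↔ (isValley Q i ∧ ht Q (i + 1) = t))

/-- A multichain of Dyck paths of type `V` from `a` to `s`: it has length
`h = hv(a)` and for every `j ∈ [h]` its `(j-1)`-st and `j`-th members have the
same valleys at every height at most `h - j`.  (The function `σ` is frozen from
index `h` on, so that such multichains are counted correctly.) -/
def IsVChain (a s : BinPath) (σ : ℕ → BinPath) : Prop :=
  σ 0 = a ∧ (∀ j, hvNat a ≤ j → σ j = s) ∧ (∀ j, IsDyck (σ j)) ∧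
  (∀ j < hvNat a, pathLe (σ j) (σ (j + 1))) ∧
  (∀ j, 1 ≤ j → j ≤ hvNat a →
    sameValleysUpTo (σ (j - 1)) (σ j) ((hvNat a : ℤ) - (j : ℤ)))

/-- `V(a,s)`: the number of `a`–`s` multichains of type `V`. -/
noncomputable def VPath (a s : BinPath) : ℕ :=
  Set.ncard {σ : ℕ → BinPath | IsVChain a s σ}

/-- `ζ^k(P,Q)`: the number of `P`–`Q` multichains of length `k`. -/
noncomputable def zetaPow (k : ℕ) (P Q : BinPath) : ℕ :=
  Set.ncard {c : ℕ → BinPath |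
    c 0 = P ∧ (∀ i, k ≤ i → c i = Q) ∧ ∀ i < k, pathLe (c i) (c (i + 1))}

/-- The join of two paths of the same length (pointwise max of heights). -/
def pathSup (P Q : BinPath) : BinPath :=
  List.ofFn (fun i : Fin P.length =>
    decide (max (ht P i.1) (ht Q i.1) < max (ht P (i.1 + 1)) (ht Q (i.1 + 1))))

/-- The meet of two paths of the same length (pointwise min of heights). -/
def pathInf (P Q : BinPath) : BinPath :=
  List.ofFn (fun i : Fin P.length =>
    decide (min (ht P i.1) (ht Q i.1) < min (ht P (i.1 + 1)) (ht Q (i.1 + 1))))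

/-- `Q` covers `P` in the lattice of binary paths. -/
def pathCovBy (P Q : BinPath) : Prop :=
  pathLt P Q ∧ ∀ R : BinPath, pathLt P R → pathLt R Q → False

/-- `l(P,Q) = (1/2)·Σᵢ (hᵢ(Q) − hᵢ(P))`. -/
def lpq (P Q : BinPath) : ℕ :=
  ((∑ i ∈ Finset.range P.length, (ht Q (i + 1) - ht P (i + 1))) / 2).toNat

/-- Convolution in the incidence algebra of the lattice of binary paths. -/
noncomputable def conv (F G : BinPath → BinPath → ℤ) : BinPath → BinPath → ℤ :=
  fun P Q => ∑ᶠ (R : BinPath) (_ : pathLe P R ∧ pathLe R Q), F P R * G R Q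

/-- The delta function of the incidence algebra. -/
def deltaFun : BinPath → BinPath → ℤ := fun P Q => if P = Q then 1 else 0

/-- `μ^k`: the `k`-th convolution power of `μ` (`μ^0` is the delta function). -/
noncomputable def muPow (mu : BinPath → BinPath → ℤ) (k : ℕ) : BinPath → BinPath → ℤ :=
  (conv mu)^[k] deltaFun

/-- The path `uxd`. -/
def elevate (x : BinPath) : BinPath := true :: (x ++ [false])

lemma length_elevate (x : BinPath) : (elevate x).length = x.length + 2 := by
  simp [elevate]

lemma elevate_injective : Function.Injective elevate := by
  intro x y h
  exact List.append_left_injective [false] (List.cons.inj h).2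

lemma ht_zero (P : BinPath) : ht P 0 = 0 := by simp [ht]

lemma ht_succ (P : BinPath) {k : ℕ} (hk : k < P.length) :
    ht P (k + 1) = ht P k + if P.getD k true then 1 else -1 := by
  rw [List.getD_eq_getElem _ _ hk, ht, ht, List.take_add_one, List.getElem?_eq_getElem hk,
    List.map_append, List.sum_append]
  simp

lemma ht_of_length_le (P : BinPath) {k : ℕ} (hk : P.length ≤ k) : ht P k = ht P P.length := by
  simp [ht, List.take_of_length_le hk]

lemma ht_elevate_succ (x : BinPath) {k : ℕ} (hk : k ≤ x.length) :
    ht (elevate x) (k + 1) = 1 + ht x k := by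
  simp [ht, elevate, List.take_append_of_le_length hk]

lemma ht_elevate_end (x : BinPath) : ht (elevate x) (x.length + 2) = ht x x.length := by
  simp [ht, elevate, List.take_of_length_le]

lemma IsDyck.ht_elevate_of_lt {x : BinPath} (hx : IsDyck x) {k : ℕ} (hk : x.length + 1 < k) :
    ht (elevate x) k = 0 := by
  rw [ht_of_length_le _ (by rw [length_elevate]; omega), length_elevate, ht_elevate_end, hx.1]

lemma IsDyck.elevate {x : BinPath} (hx : IsDyck x) : IsDyck (elevate x) := by
  refine ⟨by rw [length_elevate, ht_elevate_end, hx.1], fun k => ?_⟩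
  rcases k with _ | k
  · rw [ht_zero]
  · rcases le_or_gt k x.length with hk | hk
    · rw [ht_elevate_succ x hk]
      linarith [hx.2 k]
    · rw [hx.ht_elevate_of_lt (by omega)]

lemma pathLe_elevate_iff {x y : BinPath} (hx : IsDyck x) (hy : IsDyck y) :
    pathLe (elevate x) (elevate y) ↔ pathLe x y := by
  simp only [pathLe, length_elevate, Nat.add_right_cancel_iff]
  refine and_congr_right fun hl => ⟨fun h k => ?_, fun h k => ?_⟩
  · rcases le_or_gt k x.length with hk | hk
    · have := h (k + 1)
      rw [ht_elevate_succ x hk, ht_elevate_succ y (hl ▸ hk)] at this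
      linarith
    · rw [ht_of_length_le x hk.le, hx.1]
      exact hy.2 k
  · rcases k with _ | k
    · simp [ht_zero]
    · rcases le_or_gt k x.length with hk | hk
      · rw [ht_elevate_succ x hk, ht_elevate_succ y (hl ▸ hk)]
        linarith [h k]
      · rw [hx.ht_elevate_of_lt (by omega)]
        exact hy.elevate.2 _

lemma not_isValley_elevate_zero (x : BinPath) : ¬ isValley (elevate x) 0 := by
  simp [isValley, elevate]

lemma isValley_elevate_succ (x : BinPath) {i : ℕ} (hi : i + 1 < x.length) :
    isValley (elevate x) (i + 1) ↔ isValley x i := by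
  have h1 : i < x.length := by omega
  simp [isValley, elevate, List.getElem_append_left hi, List.getElem?_eq_getElem hi, h1, h1.le]

lemma not_isValley_elevate_length (x : BinPath) : ¬ isValley (elevate x) x.length := by
  rcases x.eq_nil_or_concat with rfl | ⟨y, b, rfl⟩ <;> simp [isValley, elevate]

lemma isValley_elevate_last (x : BinPath) : isValley (elevate x) (x.length + 1) := by
  simp [isValley, elevate]

lemma IsDyck.getD_last {P : BinPath} (hP : IsDyck P) {i : ℕ} (hi : i + 1 = P.length) :
    P.getD i true = false := by
  by_contra hb
  have h := ht_succ P (k := i) (by omega)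
  rw [if_pos (by simpa using hb), hi, hP.1] at h
  linarith [hP.2 i]

lemma IsDyck.isValley_last {P : BinPath} (hP : IsDyck P) {i : ℕ} (hi : i + 1 = P.length) :
    isValley P i :=
  ⟨by omega, hP.getD_last hi, by simp [hi]⟩

lemma sameValleysUpTo_elevate_iff {x y : BinPath} (hx : IsDyck x) (hy : IsDyck y)
    (hl : x.length = y.length) (m : ℤ) :
    sameValleysUpTo (elevate x) (elevate y) (m + 1) ↔ sameValleysUpTo x y m := by
  constructor
  · intro h i t ht
    rcases lt_trichotomy (i + 1) x.length with hi | hi | hi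
    · have := h (i + 1) (t + 1) (by omega)
      rw [isValley_elevate_succ x hi, isValley_elevate_succ y (hl ▸ hi),
        ht_elevate_succ x hi.le, ht_elevate_succ y (hl ▸ hi.le)] at this
      simpa [add_comm (1 : ℤ)] using this
    · have hx' := hx.isValley_last hi
      have hy' := hy.isValley_last (hl ▸ hi)
      simp only [hx', hy', true_and]
      rw [hi, hx.1, hl, hy.1]
    · have hx' : ¬ isValley x i := fun h => by have := h.1; omega
      have hy' : ¬ isValley y i := fun h => by have := h.1; omega
      simp [hx', hy']
  · intro h i t ht
    rcases i with _ | i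
    · simp [not_isValley_elevate_zero]
    rcases lt_trichotomy (i + 1) x.length with hi | hi | hi
    · rw [isValley_elevate_succ x hi, isValley_elevate_succ y (hl ▸ hi),
        ht_elevate_succ x hi.le, ht_elevate_succ y (hl ▸ hi.le)]
      have := h i (t - 1) (by omega)
      simpa [eq_sub_iff_add_eq, add_comm] using this
    · have hx' := not_isValley_elevate_length x
      have hy' := not_isValley_elevate_length y
      rw [← hl] at hy'
      simp [hi, hx', hy']
    · rcases Nat.lt_or_ge x.length i with hi' | hi'
      · have hx' : ¬ isValley (elevate x) (i + 1) := fun h => by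
          have := h.1
          rw [length_elevate] at this
          omega
        have hy' : ¬ isValley (elevate y) (i + 1) := fun h => by
          have := h.1
          rw [length_elevate] at this
          omega
        simp [hx', hy']
      · have hi'' : i = x.length := by omega
        have hx' := isValley_elevate_last x
        have hy' := isValley_elevate_last y
        rw [← hl] at hy'
        subst hi''
        simp only [hx', hy', true_and]
        rw [hx.ht_elevate_of_lt (by omega), hy.ht_elevate_of_lt (by omega)]

lemma sameValleysUpTo.mono {P Q : BinPath} {m m' : ℤ} (h : sameValleysUpTo P Q m)
    (hm : m' ≤ m) : sameValleysUpTo P Q m' :=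
  fun i t ht => h i t (ht.trans hm)

lemma sameValleysUpTo.trans {P Q R : BinPath} {m : ℤ} (h : sameValleysUpTo P Q m)
    (h' : sameValleysUpTo Q R m) : sameValleysUpTo P R m :=
  fun i t ht => (h i t ht).trans (h' i t ht)

lemma sameValleysUpTo_zero_elevate {x y : BinPath} (hx : IsDyck x) (hy : IsDyck y)
    (hl : x.length = y.length) : sameValleysUpTo (elevate x) (elevate y) 0 := by
  rw [← neg_add_cancel (1 : ℤ), sameValleysUpTo_elevate_iff hx hy hl]
  intro i t ht
  have h1 := hx.2 (i + 1)
  have h2 := hy.2 (i + 1)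
  constructor <;> rintro ⟨-, h⟩ <;> omega

/-- A Dyck path whose only valley at height `0` is its endpoint is of the form `uyd`. -/
lemma IsDyck.exists_eq_elevate {P x : BinPath} (hP : IsDyck P) (hx : IsDyck x)
    (hl : P.length = x.length + 2) (h : sameValleysUpTo (_root_.elevate x) P 0) :
    ∃ y, IsDyck y ∧ y.length = x.length ∧ P = _root_.elevate y := by
  obtain ⟨b, Q, rfl⟩ : ∃ b Q, P = b :: Q := by
    rcases P with _ | ⟨b, Q⟩
    · simp at hl
    · exact ⟨b, Q, rfl⟩
  obtain ⟨y, c, rfl⟩ : ∃ y c, Q = y ++ [c] := by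
    rcases Q.eq_nil_or_concat with rfl | ⟨y, c, rfl⟩
    · simp at hl
    · exact ⟨y, c, by simp⟩
  have hb : b = true := by
    by_contra hb
    have := hP.2 1
    simp [ht, hb] at this
  have hyl : y.length = x.length := by simpa using hl
  have hc : c = false := by
    simpa using hP.getD_last (i := y.length + 1) (by simp)
  subst hb hc
  change IsDyck (_root_.elevate y) at hP
  change sameValleysUpTo _ (_root_.elevate y) 0 at h
  have hend : ht y y.length = 0 := by
    rw [← ht_elevate_end, ← length_elevate, hP.1]
  refine ⟨y, ⟨hend, fun k => ?_⟩, hyl, rfl⟩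
  rcases le_or_gt y.length k with hk | hk
  · rw [ht_of_length_le y hk, hend]
  by_contra! hneg
  have hk1 := ht_elevate_succ y hk.le
  have h0 := hP.2 (k + 1)
  have h0' := hP.2 k
  have h0'' := hP.2 (k + 2)
  have s1 := ht_succ (_root_.elevate y) (k := k) (by rw [length_elevate]; omega)
  have s2 := ht_succ (_root_.elevate y) (k := k + 1) (by rw [length_elevate]; omega)
  have hz : ht (_root_.elevate y) (k + 1) = 0 := by omega
  have v : isValley (_root_.elevate y) k := by
    refine ⟨by rw [length_elevate]; omega, ?_, ?_⟩
    · by_contra hb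
      rw [if_pos (by simpa using hb)] at s1
      omega
    · by_contra hb
      rw [if_neg hb] at s2
      simp only [Nat.add_assoc, Nat.reduceAdd] at s2
      omega
  have w := ((h k 0 le_rfl).2 ⟨v, hz⟩).2
  rcases k with _ | k
  · exact not_isValley_elevate_zero y v
  · rw [ht_elevate_succ x (by omega)] at w
    linarith [hx.2 (k + 1)]

lemma eq_of_ht_eq {P Q : BinPath} (hl : P.length = Q.length) (h : ∀ k, ht P k = ht Q k) :
    P = Q := by
  refine List.ext_getElem hl fun i hi hi' => ?_
  have h1 := ht_succ P hi
  have h2 := ht_succ Q hi'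
  rw [h, h, h2] at h1
  simp only [List.getD_eq_getElem _ _ hi, List.getD_eq_getElem _ _ hi'] at h1
  cases hp : P[i] <;> cases hq : Q[i] <;> simp_all

lemma ht_le (P : BinPath) (k : ℕ) : ht P k ≤ k := by
  induction k with
  | zero => simp [ht_zero]
  | succ k ih =>
    rcases lt_or_ge k P.length with hk | hk
    · rw [ht_succ P hk]
      split_ifs <;> push_cast <;> linarith
    · rw [ht_of_length_le P (by omega), ← ht_of_length_le P hk]
      push_cast
      linarith

lemma IsDyck.ht_add_le {P : BinPath} (hP : IsDyck P) {k : ℕ} (hk : k ≤ P.length) :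
    ht P k + k ≤ P.length := by
  induction hk using Nat.decreasingInduction with
  | self => simp [hP.1]
  | of_succ k hk ih =>
    rw [ht_succ P hk] at ih
    push_cast at ih
    split_ifs at ih <;> linarith

lemma ht_eq_of_forall_true {P : BinPath} {k : ℕ} (hk : k ≤ P.length)
    (h : ∀ j < k, P.getD j true = true) : ht P k = k := by
  induction k with
  | zero => simp [ht_zero]
  | succ k ih =>
    rw [ht_succ P hk, ih (by omega) fun j hj => h j (by omega), if_pos (h k (by omega))]
    push_cast
    rfl

lemma IsDyck.ht_add_eq_of_forall_false {P : BinPath} (hP : IsDyck P) {k : ℕ}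
    (hk : k ≤ P.length) (h : ∀ j, k ≤ j → j < P.length → P.getD j true = false) :
    ht P k + k = P.length := by
  induction hk using Nat.decreasingInduction with
  | self => simp [hP.1]
  | of_succ k hk ih =>
    have := ih fun j hj => h j (by omega)
    rw [ht_succ P hk, h k le_rfl hk] at this
    push_cast at this
    linarith

lemma getD_eq_false_of_le {P : BinPath} (hv : ∀ i, isValley P i → i + 1 = P.length) {i j : ℕ}
    (hij : i ≤ j) (hi : P.getD i true = false) (hj : j < P.length) : P.getD j true = false := by
  induction hij with
  | refl => exact hi
  | @step m hm ih =>
    by_contra hb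
    have := hv m ⟨by omega, ih (by omega), by simpa using hb⟩
    simp only [Nat.succ_eq_add_one] at hj
    omega

/-- A Dyck path with no valley except its endpoint is maximal. -/
lemma IsDyck.eq_of_pathLe {a s : BinPath} (ha : IsDyck a) (hs : IsDyck s) (hle : pathLe a s)
    (hv : ∀ i, isValley a i → i + 1 = a.length) : a = s := by
  refine eq_of_ht_eq hle.1 fun k => (hle.2 k).antisymm ?_
  rcases le_or_gt a.length k with hk | hk
  · rw [ht_of_length_le s (hle.1 ▸ hk), hs.1]
    exact ha.2 k
  by_cases h : ∀ j < k, a.getD j true = true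
  · rw [ht_eq_of_forall_true hk.le h]
    exact ht_le s k
  · push Not at h
    obtain ⟨j, hj, hjd⟩ := h
    have h1 := ha.ht_add_eq_of_forall_false hk.le fun i hi hi' =>
      getD_eq_false_of_le hv (hj.le.trans hi) (by simpa using hjd) hi'
    have h2 := hs.ht_add_le (hle.1 ▸ hk.le)
    rw [← hle.1] at h2
    linarith

lemma hvNat_eq_of_isGreatest {P : BinPath} {M : ℕ}
    (h : IsGreatest {h : ℤ | ∃ i, isValley P i ∧ ht P (i + 1) = h} M) : hvNat P = M := by
  rw [hvNat, hv, h.csSup_eq, Int.toNat_natCast]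

lemma IsDyck.hvNat_elevate {a : BinPath} (ha : IsDyck a) {i : ℕ} (hi : isValley a i)
    (hil : i + 1 < a.length) : hvNat (_root_.elevate a) = hvNat a + 1 := by
  classical
  obtain ⟨m, hm, hmax⟩ := Finset.exists_max_image
    ((Finset.range a.length).filter fun i => isValley a i ∧ i + 1 < a.length)
    (fun i => ht a (i + 1)) ⟨i, by simp [hi, hil]; omega⟩
  simp only [Finset.mem_filter, Finset.mem_range, and_imp] at hm hmax
  obtain ⟨M, hM⟩ := Int.eq_ofNat_of_zero_le (ha.2 (m + 1))
  have hlow : ∀ j, isValley a j → ht a (j + 1) ≤ M := by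
    intro j hj
    rcases lt_or_ge (j + 1) a.length with h | h
    · exact hM ▸ hmax j hj.1 hj h
    · rw [ht_of_length_le a h, ha.1]
      positivity
  rw [hvNat_eq_of_isGreatest (P := a) (M := M), hvNat_eq_of_isGreatest (M := M + 1)]
  · refine ⟨⟨m + 1, (isValley_elevate_succ a hm.2.2).2 hm.2.1, ?_⟩, ?_⟩
    · rw [ht_elevate_succ a hm.2.2.le, hM]
      push_cast
      ring
    · rintro _ ⟨j, hj, rfl⟩
      push_cast
      rcases le_or_gt j a.length with h | h
      · rcases j with _ | j
        · exact absurd hj (not_isValley_elevate_zero a)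
        · rcases h.lt_or_eq with h | h
          · rw [ht_elevate_succ a h.le]
            linarith [hlow j ((isValley_elevate_succ a h).1 hj)]
          · exact absurd (h ▸ hj) (not_isValley_elevate_length a)
      · rw [ha.ht_elevate_of_lt (by omega)]
        positivity
  · refine ⟨⟨m, hm.2.1, hM⟩, ?_⟩
    rintro _ ⟨j, hj, rfl⟩
    exact hlow j hj

lemma hvNat_eq_zero {P : BinPath} (h : ∀ i, isValley P i → ht P (i + 1) = 0) : hvNat P = 0 := by
  have : hv P ≤ 0 := by
    rw [hv]
    rcases Set.eq_empty_or_nonempty {h : ℤ | ∃ i, isValley P i ∧ ht P (i + 1) = h} with he | hne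
    · simp [he]
    · refine csSup_le hne ?_
      rintro _ ⟨i, hi, rfl⟩
      exact (h i hi).le
  rw [hvNat, Int.toNat_of_nonpos this]

lemma VPath_of_hvNat_eq_zero {P Q : BinPath} (hP : IsDyck P) (h : hvNat P = 0) :
    VPath P Q = if P = Q then 1 else 0 := by
  have hset : {σ | IsVChain P Q σ} = if P = Q then {fun _ => P} else ∅ := by
    ext σ
    constructor
    · rintro ⟨h0, h1, -⟩
      have hPQ : P = Q := by rw [← h0, h1 0 (by omega)]
      rw [if_pos hPQ]
      exact funext fun j => by rw [h1 j (by omega), hPQ]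
    · split_ifs with hPQ
      · rintro rfl
        refine ⟨rfl, fun _ _ => hPQ, fun _ => hP, ?_, ?_⟩
        · intro j hj
          omega
        · intro j hj hj'
          omega
      · exact False.elim
  rw [VPath, hset]
  split_ifs <;> simp

lemma IsVChain.length_eq {a s : BinPath} {σ : ℕ → BinPath} (h : IsVChain a s σ) {j : ℕ}
    (hj : j ≤ hvNat a) : (σ j).length = a.length := by
  induction j with
  | zero => rw [h.1]
  | succ j ih => rw [← (h.2.2.2.1 j hj).1, ih (by omega)]

lemma IsVChain.sameValleysUpTo_zero {a s : BinPath} {σ : ℕ → BinPath} (h : IsVChain a s σ)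
    {j : ℕ} (hj : j ≤ hvNat a) : sameValleysUpTo a (σ j) 0 := by
  induction j with
  | zero =>
    rw [h.1]
    exact fun _ _ _ => Iff.rfl
  | succ j ih =>
    refine (ih (by omega)).trans ((h.2.2.2.2 (j + 1) (by omega) hj).mono ?_)
    push_cast
    omega

lemma finite_setOf_isVChain (a s : BinPath) : {σ | IsVChain a s σ}.Finite := by
  have hfin : (Set.univ.pi fun _ : Fin (hvNat a) => {P : BinPath | P.length = a.length}).Finite :=
    Set.Finite.pi fun _ => List.finite_length_eq Bool a.length
  refine Set.Finite.of_finite_image (f := fun σ (i : Fin (hvNat a)) => σ i)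
    (hfin.subset ?_) ?_
  · rintro _ ⟨σ, hσ, rfl⟩ i -
    exact hσ.length_eq i.2.le
  · intro σ hσ τ hτ h
    funext j
    rcases lt_or_ge j (hvNat a) with hj | hj
    · exact congrFun h ⟨j, hj⟩
    · rw [hσ.2.1 j hj, hτ.2.1 j hj]

lemma finsum_VPath (a : BinPath) {T : Set BinPath} (hT : T.Finite) :
    ∑ᶠ t ∈ T, VPath a t = Set.ncard {σ | ∃ t ∈ T, IsVChain a t σ} := by
  have hU : {σ | ∃ t ∈ T, IsVChain a t σ} = ⋃ t ∈ T, {σ | IsVChain a t σ} := by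
    ext σ
    simp
  rw [hU, hT.ncard_biUnion (fun t _ => finite_setOf_isVChain a t)]
  · rfl
  · intro t _ t' _ hne
    refine Set.disjoint_left.2 fun σ hσ hσ' => hne ?_
    rw [← hσ.2.1 _ le_rfl, hσ'.2.1 _ le_rfl]

/-- Elevation of the first `h + 1` members of a multichain, continued by the constant `usd`. -/
def elevateChain (h : ℕ) (s : BinPath) (τ : ℕ → BinPath) : ℕ → BinPath :=
  fun j => if j ≤ h then elevate (τ j) else elevate s

lemma isVChain_elevateChain {a s t : BinPath} (hs : IsDyck s) (hlen : t.length = s.length)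
    (hts : pathLe t s) (hv : hvNat (elevate a) = hvNat a + 1) {τ : ℕ → BinPath}
    (hτ : IsVChain a t τ) : IsVChain (elevate a) (elevate s) (elevateChain (hvNat a) s τ) := by
  obtain ⟨h0, h1, h2, h3, h4⟩ := id hτ
  have hcl : hvNat a ≤ hvNat a := le_rfl
  refine ⟨by simp [elevateChain, h0], fun j hj => ?_, fun j => ?_, fun j hj => ?_,
    fun j hj hj' => ?_⟩
  · rw [elevateChain, if_neg (by omega)]
  · rw [elevateChain]
    split_ifs
    exacts [(h2 j).elevate, hs.elevate]
  · rw [elevateChain, elevateChain, if_pos (by omega)]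
    split_ifs with h
    · exact (pathLe_elevate_iff (h2 _) (h2 _)).2 (h3 j h)
    · rw [h1 j (by omega)]
      exact (pathLe_elevate_iff (h1 _ hcl ▸ h2 _) hs).2 hts
  · obtain ⟨j, rfl⟩ : ∃ i, j = i + 1 := ⟨j - 1, by omega⟩
    rw [elevateChain, elevateChain, if_pos (by omega), Nat.add_sub_cancel, hv]
    split_ifs with h
    · have := h4 (j + 1) (by omega) h
      rw [Nat.add_sub_cancel, ← sameValleysUpTo_elevate_iff (h2 _) (h2 _) (h3 j h).1] at this
      refine this.mono (le_of_eq ?_)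
      push_cast
      ring
    · have hj : j = hvNat a := by omega
      rw [h1 j hj.ge]
      refine (sameValleysUpTo_zero_elevate (h1 _ hcl ▸ h2 _) hs hlen).mono ?_
      push_cast
      omega

lemma exists_elevateChain_eq {a s : BinPath} (ha : IsDyck a) (hs : IsDyck s)
    (hv : hvNat (elevate a) = hvNat a + 1) {σ : ℕ → BinPath}
    (hσ : IsVChain (elevate a) (elevate s) σ) :
    ∃ t τ, IsDyck t ∧ pathLe t s ∧ IsVChain a t τ ∧ elevateChain (hvNat a) s τ = σ := by
  have hex : ∀ j, ∃ y, j ≤ hvNat a → IsDyck y ∧ y.length = a.length ∧ σ j = elevate y := by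
    intro j
    by_cases hj : j ≤ hvNat a
    · obtain ⟨y, hy⟩ := (hσ.2.2.1 j).exists_eq_elevate ha
        ((hσ.length_eq (by omega)).trans (length_elevate a)) (hσ.sameValleysUpTo_zero (by omega))
      exact ⟨y, fun _ => hy⟩
    · exact ⟨[], fun h => absurd h hj⟩
  choose τ hτ using hex
  obtain ⟨h0, h1, h2, h3, h4⟩ := hσ
  have hc : ∀ j, min j (hvNat a) ≤ hvNat a := fun j => min_le_right _ _
  obtain ⟨d, l, e⟩ := hτ _ le_rfl
  refine ⟨τ (hvNat a), fun j => τ (min j (hvNat a)), d, ?_,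
    ⟨?_, fun j hj => by simp [hj], fun j => (hτ _ (hc j)).1, fun j hj => ?_,
    fun j hj hj' => ?_⟩, ?_⟩
  · have := h3 (hvNat a) (by omega)
    rw [h1 (hvNat a + 1) (by omega), e] at this
    exact (pathLe_elevate_iff d hs).1 this
  · have := (hτ 0 (by omega)).2.2
    rw [h0] at this
    simpa using (elevate_injective this).symm
  · have := h3 j (by omega)
    rw [(hτ j hj.le).2.2, (hτ (j + 1) hj).2.2,
      pathLe_elevate_iff (hτ j hj.le).1 (hτ (j + 1) hj).1] at this
    simpa [min_eq_left hj.le, min_eq_left (show j + 1 ≤ hvNat a from hj)] using this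
  · have ht := hτ j hj'
    have ht' := hτ (j - 1) (by omega)
    have := h4 j hj (by omega)
    rw [ht.2.2, ht'.2.2, hv, show ((hvNat a + 1 : ℕ) : ℤ) - j = (hvNat a - j) + 1 by
      push_cast; ring, sameValleysUpTo_elevate_iff ht'.1 ht.1 (ht'.2.1.trans ht.2.1.symm)] at this
    simpa [min_eq_left hj', min_eq_left (show j - 1 ≤ hvNat a by omega)] using this
  · funext j
    rw [elevateChain]
    split_ifs with hj
    · simp only [min_eq_left hj]
      exact (hτ j hj).2.2.symm
    · exact (h1 j (by omega)).symm

/-- For Dyck paths `a ≤ s` of the same length,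
`V(uad, usd) = Σ_{t ≤ s} V(a, t)`, summed over Dyck paths `t` of length `|s|`
with `t ≤ s`. -/
theorem statement14 (a s : BinPath) (ha : IsDyck a) (hs : IsDyck s)
    (hlen : a.length = s.length) (hle : pathLe a s) :
    VPath (true :: (a ++ [false])) (true :: (s ++ [false]))
      = ∑ᶠ (t : BinPath) (_ : IsDyck t ∧ t.length = s.length ∧ pathLe t s),
          VPath a t := by
  have hT : {t : BinPath | IsDyck t ∧ t.length = s.length ∧ pathLe t s}.Finite :=
    (List.finite_length_eq Bool s.length).subset fun t ht => ht.2.1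
  by_cases hv : ∃ i, isValley a i ∧ i + 1 < a.length
  · obtain ⟨i, hi, hil⟩ := hv
    have hv := ha.hvNat_elevate hi hil
    refine Eq.trans ?_ (finsum_VPath a hT).symm
    rw [← Set.InjOn.ncard_image (f := elevateChain (hvNat a) s)]
    · refine congrArg Set.ncard (Set.Subset.antisymm ?_ ?_)
      · intro σ hσ
        obtain ⟨t, τ, ht, hts, hτ, rfl⟩ := exists_elevateChain_eq ha hs hv hσ
        exact ⟨τ, ⟨t, ⟨ht, hts.1, hts⟩, hτ⟩, rfl⟩
      · rintro _ ⟨τ, ⟨t, ht, hτ⟩, rfl⟩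
        exact isVChain_elevateChain hs ht.2.1 ht.2.2 hv hτ
    · rintro τ ⟨t, -, hτ⟩ τ' ⟨t', -, hτ'⟩ h
      have key : ∀ j ≤ hvNat a, τ j = τ' j := fun j hj => by
        have := congrFun h j
        rw [elevateChain, elevateChain, if_pos hj, if_pos hj] at this
        exact elevate_injective this
      funext j
      rcases le_total j (hvNat a) with hj | hj
      · exact key j hj
      · rw [hτ.2.1 j hj, hτ'.2.1 j hj, ← hτ.2.1 _ le_rfl, ← hτ'.2.1 _ le_rfl, key _ le_rfl]
  · push Not at hv
    have hv' : ∀ i, isValley a i → i + 1 = a.length := fun i hi =>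
      le_antisymm hi.1 (hv i hi)
    obtain rfl := ha.eq_of_pathLe hs hle hv'
    have h0 : hvNat a = 0 := hvNat_eq_zero fun i hi => by rw [hv' i hi, ha.1]
    have h0' : hvNat (elevate a) = 0 := by
      refine hvNat_eq_zero fun i hi => ?_
      rcases i with _ | i
      · exact absurd hi (not_isValley_elevate_zero a)
      rcases lt_trichotomy (i + 1) a.length with h | h | h
      · have := hv' i ((isValley_elevate_succ a h).1 hi)
        omega
      · exact absurd (h ▸ hi) (not_isValley_elevate_length a)
      · exact ha.ht_elevate_of_lt (by omega)
    have h1 : VPath (elevate a) (elevate a) = 1 := by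
      rw [VPath_of_hvNat_eq_zero ha.elevate h0', if_pos rfl]
    refine h1.trans ?_
    classical
    rw [finsum_eq_single _ a]
    · rw [finsum_eq_if, if_pos ⟨ha, rfl, hle⟩, VPath_of_hvNat_eq_zero ha h0, if_pos rfl]
    · intro t ht
      rw [VPath_of_hvNat_eq_zero ha h0, if_neg ht.symm, finsum_zero]
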